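/- arXiv:2209.01033 — 2 statements merged into one kernel-verified Lean document; each statement's English description precedes it below -/
import Mathlib

section
/- Let Y be a nonempty compact subset of A and c_Y ≥ 0 with ‖y‖_A ≤ c_Y for all y ∈ Y. Suppose each H_i : |γ| → |γ| is Lipschitz with L̄ := max_i L(H_i) < 1, set λ := max_i (L(q_i) + c_Y·L(s_i)), assume λ > 0, and put ϑ := (1 − L̄)/(2λ). Then each map w_i(x,y) := (H_i(x), q_i(x) + s_i(x)·y) on |γ| × Y satisfies ‖w_i(x₁,y₁) − w_i(x₂,y₂)‖_ϑ ≤ max{(1 + L̄)/2, max_j ‖s_j‖_∞}·‖(x₁ − x₂, y₁ − y₂)‖_ϑ for all (x₁,y₁), (x₂,y₂) ∈ |γ| × Y; in particular, if max_j ‖s_j‖_∞ < 1, each w_i is a contraction with respect to ‖·‖_ϑ. -/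
/-- The sup norm `‖f‖_∞` of `f` restricted to a subset `S` of its domain. -/
noncomputable def supNormOn {α F : Type*} [NormedAddCommGroup F] (f : α → F) (S : Set α) : ℝ :=
  ⨆ x : S, ‖f x.1‖

/-- The smallest Lipschitz constant `L(f)` of `f` restricted to a subset `S` of its domain. -/
noncomputable def lipConstOn {α F : Type*} [NormedAddCommGroup α] [NormedAddCommGroup F]
    (f : α → F) (S : Set α) : ℝ :=
  sInf {K : ℝ | 0 ≤ K ∧ ∀ x ∈ S, ∀ y ∈ S, ‖f x - f y‖ ≤ K * ‖x - y‖}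

/-- `f` is bounded and Lipschitz on the subset `S` of its domain. -/
def BddLipschitzOn {α F : Type*} [NormedAddCommGroup α] [NormedAddCommGroup F]
    (f : α → F) (S : Set α) : Prop :=
  BddAbove ((fun x => ‖f x‖) '' S) ∧
    ∃ K : ℝ, 0 ≤ K ∧ ∀ x ∈ S, ∀ y ∈ S, ‖f x - f y‖ ≤ K * ‖x - y‖

/-- The infimum defining `lipConstOn` is attained. -/
theorem norm_sub_le_lipConstOn_mul {α F : Type*} [NormedAddCommGroup α] [NormedAddCommGroup F]
    {f : α → F} {S : Set α}
    (hf : ∃ K : ℝ, 0 ≤ K ∧ ∀ x ∈ S, ∀ y ∈ S, ‖f x - f y‖ ≤ K * ‖x - y‖)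
    {x y : α} (hx : x ∈ S) (hy : y ∈ S) : ‖f x - f y‖ ≤ lipConstOn f S * ‖x - y‖ := by
  rcases eq_or_ne x y with rfl | hxy
  · simp
  have hpos : 0 < ‖x - y‖ := norm_pos_iff.2 (sub_ne_zero.2 hxy)
  rw [← div_le_iff₀ hpos]
  exact le_csInf hf fun K hK => (div_le_iff₀ hpos).2 (hK.2 x hx y hy)

theorem norm_le_supNormOn {α F : Type*} [NormedAddCommGroup F] {f : α → F} {S : Set α}
    (hf : BddAbove ((fun x => ‖f x‖) '' S)) {x : α} (hx : x ∈ S) : ‖f x‖ ≤ supNormOn f S := by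
  refine le_ciSup (f := fun x : S => ‖f x.1‖) ?_ ⟨x, hx⟩
  rwa [Set.image_eq_range] at hf

theorem norm_add_mul_sub_add_mul_le {A : Type*} [NormedRing A] (a₁ a₂ b₁ b₂ y₁ y₂ : A) :
    ‖(a₁ + b₁ * y₁) - (a₂ + b₂ * y₂)‖ ≤
      ‖a₁ - a₂‖ + ‖b₁ - b₂‖ * ‖y₂‖ + ‖b₁‖ * ‖y₁ - y₂‖ := by
  have h : (a₁ + b₁ * y₁) - (a₂ + b₂ * y₂) =
      (a₁ - a₂) + (b₁ - b₂) * y₂ + b₁ * (y₁ - y₂) := by noncomm_ring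
  rw [h]
  exact (norm_add₃_le).trans (by gcongr <;> exact norm_mul_le _ _)

/-- **The IFS maps `w_i(x,y) = (H_i(x), q_i(x) + s_i(x)·y)` are contractive in the norm
`‖(x,y)‖_ϑ = ‖x‖_E + ϑ·‖y‖_A`.**  Let `Y ⊆ A` be nonempty compact with `‖y‖ ≤ c_Y` on `Y`,
let each `H_i : Γ → Γ` be Lipschitz with `L̄ := max_i L(H_i) < 1`, set
`λ := max_i (L(q_i) + c_Y·L(s_i)) > 0` and `ϑ := (1 − L̄)/(2λ)`.  Then for all
`(x₁,y₁), (x₂,y₂) ∈ Γ × Y`,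
`‖w_i(x₁,y₁) − w_i(x₂,y₂)‖_ϑ ≤ max{(1 + L̄)/2, max_j ‖s_j‖_∞}·‖(x₁ − x₂, y₁ − y₂)‖_ϑ`;
in particular if `max_j ‖s_j‖_∞ < 1` the contraction factor is `< 1`, so each `w_i` is a
contraction with respect to `‖·‖_ϑ`. -/
theorem ifs_maps_contractive_theta_norm
    {E A : Type*} [NormedAddCommGroup E] [NormedSpace ℝ E] [CompleteSpace E]
    [NormedRing A] [NormOneClass A] [NormedAlgebra ℝ A] [CompleteSpace A]
    (γ γ' : ℝ → E)
    (hγd : ∀ t ∈ Set.Icc (0:ℝ) 1, HasDerivWithinAt γ (γ' t) (Set.Icc (0:ℝ) 1) t)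
    (hγ'c : ContinuousOn γ' (Set.Icc (0:ℝ) 1))
    (hγinj : Set.InjOn γ (Set.Icc (0:ℝ) 1))
    (hreg : ∀ t ∈ Set.Icc (0:ℝ) 1, γ' t ≠ 0)
    (Γ : Set E) (hΓ : Γ = γ '' Set.Icc (0:ℝ) 1)
    (n : ℕ) (hn : 1 ≤ n)
    (q s : Fin n → E → A)
    (hq : ∀ i, BddLipschitzOn (q i) Γ)
    (hs : ∀ i, BddLipschitzOn (s i) Γ)
    (H : Fin n → E → E)
    (hHmaps : ∀ i, Set.MapsTo (H i) Γ Γ)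
    (hHlip : ∀ i, ∃ K : ℝ, 0 ≤ K ∧ ∀ x ∈ Γ, ∀ y ∈ Γ, ‖H i x - H i y‖ ≤ K * ‖x - y‖)
    (Y : Set A) (hYne : Y.Nonempty) (hYcomp : IsCompact Y)
    (cY : ℝ) (hcY : 0 ≤ cY) (hYb : ∀ y ∈ Y, ‖y‖ ≤ cY)
    (Lbar lam ϑ : ℝ)
    (hLbardef : Lbar = ⨆ i : Fin n, lipConstOn (H i) Γ)
    (hLbar : Lbar < 1)
    (hlamdef : lam = ⨆ i : Fin n, (lipConstOn (q i) Γ + cY * lipConstOn (s i) Γ))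
    (hlam : 0 < lam)
    (hϑdef : ϑ = (1 - Lbar) / (2 * lam)) :
    (∀ i : Fin n, ∀ x₁ ∈ Γ, ∀ x₂ ∈ Γ, ∀ y₁ ∈ Y, ∀ y₂ ∈ Y,
      ‖H i x₁ - H i x₂‖ + ϑ * ‖(q i x₁ + s i x₁ * y₁) - (q i x₂ + s i x₂ * y₂)‖ ≤
        max ((1 + Lbar) / 2) (⨆ j : Fin n, supNormOn (s j) Γ) *
          (‖x₁ - x₂‖ + ϑ * ‖y₁ - y₂‖)) ∧
    ((⨆ j : Fin n, supNormOn (s j) Γ) < 1 →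
      max ((1 + Lbar) / 2) (⨆ j : Fin n, supNormOn (s j) Γ) < 1) := by
  refine ⟨fun i x₁ hx₁ x₂ hx₂ y₁ hy₁ y₂ hy₂ => ?_, fun h => max_lt (by linarith) h⟩
  have hϑ : 0 ≤ ϑ := by
    rw [hϑdef]
    exact div_nonneg (by linarith) (by linarith)
  have hϑlam : ϑ * lam = (1 - Lbar) / 2 := by
    rw [hϑdef]
    field_simp
  set M := max ((1 + Lbar) / 2) (⨆ j : Fin n, supNormOn (s j) Γ)
  have hHi : lipConstOn (H i) Γ ≤ Lbar :=
    hLbardef ▸ le_ciSup (f := fun i => lipConstOn (H i) Γ) (Set.finite_range _).bddAbove i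
  have hlami : lipConstOn (q i) Γ + cY * lipConstOn (s i) Γ ≤ lam :=
    hlamdef ▸ le_ciSup (f := fun i => lipConstOn (q i) Γ + cY * lipConstOn (s i) Γ)
      (Set.finite_range _).bddAbove i
  have hsM : ‖s i x₁‖ ≤ M :=
    (norm_le_supNormOn (hs i).1 hx₁).trans <|
      (le_ciSup (f := fun j => supNormOn (s j) Γ) (Set.finite_range _).bddAbove i).trans
        (le_max_right _ _)
  have hH : ‖H i x₁ - H i x₂‖ ≤ Lbar * ‖x₁ - x₂‖ :=
    (norm_sub_le_lipConstOn_mul (hHlip i) hx₁ hx₂).trans (by gcongr)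
  have hw : ‖(q i x₁ + s i x₁ * y₁) - (q i x₂ + s i x₂ * y₂)‖ ≤
      lam * ‖x₁ - x₂‖ + M * ‖y₁ - y₂‖ :=
    calc
      _ ≤ ‖q i x₁ - q i x₂‖ + ‖s i x₁ - s i x₂‖ * ‖y₂‖ + ‖s i x₁‖ * ‖y₁ - y₂‖ :=
        norm_add_mul_sub_add_mul_le _ _ _ _ _ _
      _ ≤ lipConstOn (q i) Γ * ‖x₁ - x₂‖ + (lipConstOn (s i) Γ * ‖x₁ - x₂‖) * cY +
          M * ‖y₁ - y₂‖ := by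
        have hqi := norm_sub_le_lipConstOn_mul (hq i).2 hx₁ hx₂
        have hsi := norm_sub_le_lipConstOn_mul (hs i).2 hx₁ hx₂
        exact add_le_add (add_le_add hqi (mul_le_mul hsi (hYb y₂ hy₂) (norm_nonneg _)
          ((norm_nonneg _).trans hsi))) (by gcongr)
      _ = (lipConstOn (q i) Γ + cY * lipConstOn (s i) Γ) * ‖x₁ - x₂‖ + M * ‖y₁ - y₂‖ := by ring
      _ ≤ lam * ‖x₁ - x₂‖ + M * ‖y₁ - y₂‖ := by gcongr
  calc
    _ ≤ Lbar * ‖x₁ - x₂‖ + ϑ * (lam * ‖x₁ - x₂‖ + M * ‖y₁ - y₂‖) := by gcongr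
    _ = (1 + Lbar) / 2 * ‖x₁ - x₂‖ + M * (ϑ * ‖y₁ - y₂‖) := by
      linear_combination ‖x₁ - x₂‖ * hϑlam
    _ ≤ M * ‖x₁ - x₂‖ + M * (ϑ * ‖y₁ - y₂‖) := by
      gcongr
      exact le_max_left _ _
    _ = M * (‖x₁ - x₂‖ + ϑ * ‖y₁ - y₂‖) := by ring
end

section
/- Assume L(T) := max{max_i ‖s_i‖_∞, max_i L(s_i)·‖γ'‖_∞} < 1, let ψ : |γ| → A be the unique bounded Lipschitz fixed point of T, let Y be a nonempty compact subset of A containing the range of ψ, and assume each w_i(x,y) := (H_i(x), q_i(x) + s_i(x)·y) maps |γ| × Y into |γ| × Y and is a contraction with respect to the norm ‖(x,y)‖_ϑ = ‖x‖_E + ϑ‖y‖_A for some ϑ > 0. Then the graph G(ψ) := {(x, ψ(x)) : x ∈ |γ|} is a nonempty compact subset of |γ| × Y satisfying G(ψ) = ⋃_{i=1}^n w_i(G(ψ)), and it is the unique nonempty compact subset of |γ| × Y with this self-referential property; i.e., G(ψ) is the attractor of the iterated function system (|γ| × Y, {w_1,…,w_n}). -/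
/-- A compact set covered by its own images under maps contracting a separating continuous gauge
`d` is contained in every nonempty compact set invariant under these maps. -/
theorem IsCompact.subset_of_subset_iUnion_image_of_contracting {X ι : Type*} [TopologicalSpace X]
    {d : X → X → ℝ} (hd : Continuous (Function.uncurry d)) (hd0 : ∀ x y, d x y ≤ 0 → x = y)
    {w : ι → X → X} {c : ℝ} (hc0 : 0 ≤ c) (hc1 : c < 1) {K L : Set X}
    (hK : IsCompact K) (hL : IsCompact L) (hLne : L.Nonempty)
    (hKw : K ⊆ ⋃ i, w i '' K) (hLw : ∀ i, Set.MapsTo (w i) L L)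
    (hw : ∀ i, ∀ x ∈ K, ∀ y ∈ L, d (w i x) (w i y) ≤ c * d x y) : K ⊆ L := by
  obtain ⟨M, hM⟩ := (hK.prod hL).bddAbove_image hd.continuousOn
  have key : ∀ k : ℕ, ∀ x ∈ K, ∃ y ∈ L, d x y ≤ c ^ k * M := by
    intro k
    induction k with
    | zero =>
      intro x hx
      obtain ⟨y, hy⟩ := hLne
      refine ⟨y, hy, ?_⟩
      simpa using hM (Set.mem_image_of_mem (Function.uncurry d) (Set.mk_mem_prod hx hy))
    | succ k ih =>
      intro x hx
      obtain ⟨i, x', hx', rfl⟩ := Set.mem_iUnion.1 (hKw hx)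
      obtain ⟨y, hy, hxy⟩ := ih x' hx'
      refine ⟨w i y, hLw i hy, (hw i x' hx' y hy).trans ?_⟩
      rw [pow_succ', mul_assoc]
      exact mul_le_mul_of_nonneg_left hxy hc0
  intro x hx
  have hdx : Continuous (d x) := hd.comp (Continuous.prodMk_right x)
  obtain ⟨y, hy, hmin⟩ := hL.exists_isMinOn hLne hdx.continuousOn
  have hlim : Filter.Tendsto (fun k : ℕ => c ^ k * M) Filter.atTop (nhds 0) := by
    simpa using (tendsto_pow_atTop_nhds_zero_of_lt_one hc0 hc1).mul_const M
  have hle : d x y ≤ 0 := ge_of_tendsto' hlim fun k => by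
    obtain ⟨z, hz, hxz⟩ := key k x hx
    exact (hmin hz).trans hxz
  exact hd0 x y hle ▸ hy

/-- The intervals between consecutive points of a finite sequence cover the interval between its
first and last points. -/
theorem Fin.exists_mem_Icc_castSucc_succ {α : Type*} [LinearOrder α] {n : ℕ} (hn : 0 < n)
    {f : Fin (n + 1) → α} (hf : Monotone f) {u : α}
    (hu : u ∈ Set.Icc (f 0) (f (Fin.last n))) :
    ∃ i : Fin n, u ∈ Set.Icc (f i.castSucc) (f i.succ) := by
  have key : ∀ k : Fin (n + 1), u ≤ f k →
      u ≤ f 0 ∨ ∃ i : Fin n, u ∈ Set.Icc (f i.castSucc) (f i.succ) := by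
    intro k
    induction k using Fin.induction with
    | zero => exact Or.inl
    | succ i ih =>
      intro hi
      rcases le_total u (f i.castSucc) with h | h
      · exact ih h
      · exact Or.inr ⟨i, h, hi⟩
  rcases key _ hu.2 with h | h
  · exact ⟨⟨0, hn⟩, hu.1, h.trans (hf (Fin.zero_le _))⟩
  · exact h

/-- A bounded Lipschitz map is continuous. -/
theorem BddLipschitzOn.continuousOn {α F : Type*} [NormedAddCommGroup α] [NormedAddCommGroup F]
    {f : α → F} {S : Set α} (hf : BddLipschitzOn f S) : ContinuousOn f S := by
  obtain ⟨-, K, -, hK⟩ := hf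
  refine (LipschitzOnWith.of_dist_le' (K := K) fun x hx y hy => ?_).continuousOn
  simpa only [dist_eq_norm] using hK x hx y hy

/-- **The graph of the fractal function is the attractor of the associated IFS.**
Assume `L(T) < 1`, let `ψ : Γ → A` be the (unique) bounded Lipschitz fixed point of the
Read–Bajraktarević operator, i.e. `ψ(γ(h_i(t))) = q_i(γ(t)) + s_i(γ(t))·ψ(γ(t))`, let `Y`
be a nonempty compact subset of `A` containing the range of `ψ`, and assume each map
`w_i(x,y) := (H_i(x), q_i(x) + s_i(x)·y)` (where `H_i(γ(t)) = γ(h_i(t))`) maps `Γ × Y` into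
itself and is a contraction for the norm `‖(x,y)‖_ϑ = ‖x‖ + ϑ‖y‖` for some `ϑ > 0`.  Then
the graph `G(ψ) = {(x, ψ(x)) : x ∈ Γ}` is a nonempty compact subset of `Γ × Y` with
`G(ψ) = ⋃ i, w_i(G(ψ))`, and it is the unique nonempty compact subset of `Γ × Y` with this
self-referential property, i.e. `G(ψ)` is the attractor of the IFS `(Γ × Y, {w_1,…,w_n})`. -/
theorem graph_of_fractal_function_is_attractor
    {E A : Type*} [NormedAddCommGroup E] [NormedSpace ℝ E] [CompleteSpace E]
    [NormedRing A] [NormOneClass A] [NormedAlgebra ℝ A] [CompleteSpace A]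
    (γ γ' : ℝ → E)
    (hγd : ∀ t ∈ Set.Icc (0:ℝ) 1, HasDerivWithinAt γ (γ' t) (Set.Icc (0:ℝ) 1) t)
    (hγ'c : ContinuousOn γ' (Set.Icc (0:ℝ) 1))
    (hγinj : Set.InjOn γ (Set.Icc (0:ℝ) 1))
    (hreg : ∀ t ∈ Set.Icc (0:ℝ) 1, γ' t ≠ 0)
    (Γ : Set E) (hΓ : Γ = γ '' Set.Icc (0:ℝ) 1)
    (n : ℕ) (hn : 1 ≤ n)
    (tp : Fin (n+1) → ℝ) (htp0 : tp 0 = 0) (htpn : tp (Fin.last n) = 1)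
    (htpm : StrictMono tp)
    (h : Fin n → ℝ → ℝ)
    (hhm : ∀ i, StrictMonoOn (h i) (Set.Icc (0:ℝ) 1))
    (hhc : ∀ i, ContinuousOn (h i) (Set.Icc (0:ℝ) 1))
    (hhim : ∀ i, h i '' Set.Icc (0:ℝ) 1 = Set.Icc (tp i.castSucc) (tp i.succ))
    (q s : Fin n → E → A)
    (hq : ∀ i, BddLipschitzOn (q i) Γ)
    (hs : ∀ i, BddLipschitzOn (s i) Γ)
    (H : Fin n → E → E)
    (hH : ∀ i, ∀ t ∈ Set.Icc (0:ℝ) 1, H i (γ t) = γ (h i t))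
    (LT : ℝ)
    (hLTdef : LT = max (⨆ i : Fin n, supNormOn (s i) Γ)
      ((⨆ i : Fin n, lipConstOn (s i) Γ) * supNormOn γ' (Set.Icc (0:ℝ) 1)))
    (hLT : LT < 1)
    (ψ : E → A) (hψ : BddLipschitzOn ψ Γ)
    (hψfix : ∀ i, ∀ t ∈ Set.Icc (0:ℝ) 1,
      ψ (γ (h i t)) = q i (γ t) + s i (γ t) * ψ (γ t))
    (Y : Set A) (hYne : Y.Nonempty) (hYcomp : IsCompact Y)
    (hψY : ∀ x ∈ Γ, ψ x ∈ Y)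
    (hw : ∀ i, Set.MapsTo (fun p : E × A => (H i p.1, q i p.1 + s i p.1 * p.2))
      (Γ ×ˢ Y) (Γ ×ˢ Y))
    (ϑ : ℝ) (hϑ : 0 < ϑ)
    (hcontr : ∃ c : ℝ, 0 ≤ c ∧ c < 1 ∧ ∀ i : Fin n, ∀ p₁ ∈ Γ ×ˢ Y, ∀ p₂ ∈ Γ ×ˢ Y,
      ‖H i p₁.1 - H i p₂.1‖ +
          ϑ * ‖(q i p₁.1 + s i p₁.1 * p₁.2) - (q i p₂.1 + s i p₂.1 * p₂.2)‖ ≤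
        c * (‖p₁.1 - p₂.1‖ + ϑ * ‖p₁.2 - p₂.2‖)) :
    ((fun x => (x, ψ x)) '' Γ).Nonempty ∧
    IsCompact ((fun x => (x, ψ x)) '' Γ) ∧
    (fun x => (x, ψ x)) '' Γ ⊆ Γ ×ˢ Y ∧
    (fun x => (x, ψ x)) '' Γ =
      ⋃ i : Fin n, (fun p : E × A => (H i p.1, q i p.1 + s i p.1 * p.2)) ''
        ((fun x => (x, ψ x)) '' Γ) ∧
    ∀ K : Set (E × A), K.Nonempty → IsCompact K → K ⊆ Γ ×ˢ Y →
      K = ⋃ i : Fin n, (fun p : E × A => (H i p.1, q i p.1 + s i p.1 * p.2)) '' K →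
      K = (fun x => (x, ψ x)) '' Γ := by
  obtain ⟨c, hc0, hc1, hc⟩ := hcontr
  have hmem : ∀ i, ∀ t ∈ Set.Icc (0:ℝ) 1, h i t ∈ Set.Icc (0:ℝ) 1 := by
    intro i t ht
    have hit : h i t ∈ Set.Icc (tp i.castSucc) (tp i.succ) := hhim i ▸ Set.mem_image_of_mem _ ht
    exact ⟨(htp0.symm.le.trans (htpm.monotone (Fin.zero_le _))).trans hit.1,
      hit.2.trans ((htpm.monotone (Fin.le_last _)).trans htpn.le)⟩
  have hΓcomp : IsCompact Γ :=
    hΓ ▸ isCompact_Icc.image_of_continuousOn fun t ht => (hγd t ht).continuousWithinAt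
  have hΓne : Γ.Nonempty := hΓ ▸ (Set.nonempty_Icc.2 zero_le_one).image γ
  have hGne : ((fun x => (x, ψ x)) '' Γ).Nonempty := hΓne.image _
  have hGcomp : IsCompact ((fun x => (x, ψ x)) '' Γ) :=
    hΓcomp.image_of_continuousOn (continuousOn_id.prodMk hψ.continuousOn)
  have hGsub : (fun x => (x, ψ x)) '' Γ ⊆ Γ ×ˢ Y := by
    rintro _ ⟨x, hx, rfl⟩
    exact ⟨hx, hψY x hx⟩
  have hwγ : ∀ i, ∀ t ∈ Set.Icc (0:ℝ) 1,
      (H i (γ t), q i (γ t) + s i (γ t) * ψ (γ t)) = (γ (h i t), ψ (γ (h i t))) := by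
    intro i t ht
    rw [hH i t ht, hψfix i t ht]
  have hGeq : (fun x => (x, ψ x)) '' Γ =
      ⋃ i : Fin n, (fun p : E × A => (H i p.1, q i p.1 + s i p.1 * p.2)) ''
        ((fun x => (x, ψ x)) '' Γ) := by
    subst hΓ
    apply Set.Subset.antisymm
    · rintro _ ⟨_, ⟨u, hu, rfl⟩, rfl⟩
      obtain ⟨i, hi⟩ := Fin.exists_mem_Icc_castSucc_succ hn htpm.monotone (u := u)
        (by rwa [htp0, htpn])
      rw [← hhim i] at hi
      obtain ⟨t, ht, rfl⟩ := hi
      exact Set.mem_iUnion.2 ⟨i, _, ⟨_, ⟨t, ht, rfl⟩, rfl⟩, hwγ i t ht⟩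
    · refine Set.iUnion_subset fun i => ?_
      rintro _ ⟨_, ⟨_, ⟨t, ht, rfl⟩, rfl⟩, rfl⟩
      exact ⟨γ (h i t), ⟨_, hmem i t ht, rfl⟩, (hwγ i t ht).symm⟩
  refine ⟨hGne, hGcomp, hGsub, hGeq, fun K hKne hKcomp hKsub hKeq => ?_⟩
  have hmaps : ∀ S : Set (E × A),
      S = ⋃ i : Fin n, (fun p : E × A => (H i p.1, q i p.1 + s i p.1 * p.2)) '' S →
      ∀ i, Set.MapsTo (fun p : E × A => (H i p.1, q i p.1 + s i p.1 * p.2)) S S := by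
    intro S hS i p hp
    rw [hS]
    exact Set.mem_iUnion.2 ⟨i, p, hp, rfl⟩
  let d : E × A → E × A → ℝ := fun p₁ p₂ => ‖p₁.1 - p₂.1‖ + ϑ * ‖p₁.2 - p₂.2‖
  have hd : Continuous (Function.uncurry d) := by
    change Continuous fun z : (E × A) × (E × A) => ‖z.1.1 - z.2.1‖ + ϑ * ‖z.1.2 - z.2.2‖
    fun_prop
  have hd0 : ∀ p₁ p₂, d p₁ p₂ ≤ 0 → p₁ = p₂ := by
    intro p₁ p₂ hp
    have h2 : 0 ≤ ϑ * ‖p₁.2 - p₂.2‖ := by positivity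
    have hp' : ‖p₁.1 - p₂.1‖ + ϑ * ‖p₁.2 - p₂.2‖ ≤ 0 := hp
    refine Prod.ext (sub_eq_zero.1 (norm_le_zero_iff.1 (by linarith)))
      (sub_eq_zero.1 (norm_le_zero_iff.1 (nonpos_of_mul_nonpos_right ?_ hϑ)))
    linarith [norm_nonneg (p₁.1 - p₂.1)]
  exact Set.Subset.antisymm
    (hKcomp.subset_of_subset_iUnion_image_of_contracting hd hd0 hc0 hc1 hGcomp hGne hKeq.subset
      (hmaps _ hGeq) fun i p₁ h₁ p₂ h₂ => hc i p₁ (hKsub h₁) p₂ (hGsub h₂))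
    (hGcomp.subset_of_subset_iUnion_image_of_contracting hd hd0 hc0 hc1 hKcomp hKne hGeq.subset
      (hmaps _ hKeq) fun i p₁ h₁ p₂ h₂ => hc i p₁ (hGsub h₁) p₂ (hKsub h₂))
end
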